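/- arXiv:2503.09500 — 6 statements merged into one kernel-verified Lean document; each statement's English description precedes it below -/
import Mathlib

section
/- Let E/F be a quadratic Galois extension of fields of characteristic zero with σ the nontrivial element of Gal(E/F), and write M* := (M^σ)ᵀ for the conjugate transpose of a matrix M over E. Let τ₁, τ₂ ∈ GL_n(E) be Hermitian (τᵢ* = τᵢ), set τ = fromBlocks(τ₁,0,0,τ₂) ∈ GL_{2n}(E) and ε = fromBlocks(I_n,0,0,-I_n). Suppose x ∈ M_{2n}(E), written in n×n blocks as x = [[a,b],[c,d]], satisfies x·τ·x* = τ and ε·x·ε·x = I_{2n}. Then x is invertible with x⁻¹ = τ·x*·τ⁻¹, and: a = τ₁·a*·τ₁⁻¹, d = τ₂·d*·τ₂⁻¹, c = -τ₂·b*·τ₁⁻¹, a² = I_n - b·(τ₂ b* τ₁⁻¹), d² = I_n - (τ₂ b* τ₁⁻¹)·b, a·b = b·d, and (τ₂ b* τ₁⁻¹)·a = d·(τ₂ b* τ₁⁻¹). -/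
open Matrix

/-- block description of elements of the split-inert unitary symmetric
space `U(V_{τ₁} ⊕ V_{τ₂}) / (U(V_{τ₁}) × U(V_{τ₂}))`. -/
theorem statement1 {F E : Type*} [Field F] [Field E] [CharZero F] [Algebra F E]
    [IsGalois F E] (hdim : Module.finrank F E = 2)
    (σ : E ≃ₐ[F] E) (hσ : σ ≠ AlgEquiv.refl)
    {n : ℕ} (τ₁ τ₂ : Matrix (Fin n) (Fin n) E)
    (hτ₁u : IsUnit τ₁) (hτ₂u : IsUnit τ₂)
    (hτ₁ : (τ₁.map ⇑σ)ᵀ = τ₁) (hτ₂ : (τ₂.map ⇑σ)ᵀ = τ₂)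
    (a b c d : Matrix (Fin n) (Fin n) E)
    (x : Matrix (Fin n ⊕ Fin n) (Fin n ⊕ Fin n) E)
    (hx : x = fromBlocks a b c d)
    (τ : Matrix (Fin n ⊕ Fin n) (Fin n ⊕ Fin n) E)
    (hτ : τ = fromBlocks τ₁ 0 0 τ₂)
    (ε : Matrix (Fin n ⊕ Fin n) (Fin n ⊕ Fin n) E)
    (hε : ε = fromBlocks (1 : Matrix (Fin n) (Fin n) E) 0 0 (-1))
    (hherm : x * τ * (x.map ⇑σ)ᵀ = τ)
    (hsym : ε * x * ε * x = 1) :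
    IsUnit x ∧
    x⁻¹ = τ * (x.map ⇑σ)ᵀ * τ⁻¹ ∧
    a = τ₁ * (a.map ⇑σ)ᵀ * τ₁⁻¹ ∧
    d = τ₂ * (d.map ⇑σ)ᵀ * τ₂⁻¹ ∧
    c = -(τ₂ * (b.map ⇑σ)ᵀ * τ₁⁻¹) ∧
    a * a = 1 - b * (τ₂ * (b.map ⇑σ)ᵀ * τ₁⁻¹) ∧
    d * d = 1 - (τ₂ * (b.map ⇑σ)ᵀ * τ₁⁻¹) * b ∧
    a * b = b * d ∧
    (τ₂ * (b.map ⇑σ)ᵀ * τ₁⁻¹) * a = d * (τ₂ * (b.map ⇑σ)ᵀ * τ₁⁻¹) := by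
  have d1 : IsUnit τ₁.det := (Matrix.isUnit_iff_isUnit_det _).1 hτ₁u
  have d2 : IsUnit τ₂.det := (Matrix.isUnit_iff_isUnit_det _).1 hτ₂u
  have dτ : IsUnit τ.det := by
    rw [hτ, Matrix.det_fromBlocks_zero₂₁]
    exact d1.mul d2
  have hright : x * (τ * (x.map ⇑σ)ᵀ * τ⁻¹) = 1 := by
    rw [← Matrix.mul_assoc, ← Matrix.mul_assoc, hherm, Matrix.mul_nonsing_inv _ dτ]
  have hinv : x⁻¹ = τ * (x.map ⇑σ)ᵀ * τ⁻¹ := Matrix.inv_eq_right_inv hright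
  have hkey : ε * x * ε * τ = τ * (x.map ⇑σ)ᵀ := by
    calc ε * x * ε * τ = ε * x * ε * (x * τ * (x.map ⇑σ)ᵀ) := by rw [hherm]
      _ = (ε * x * ε * x) * (τ * (x.map ⇑σ)ᵀ) := by simp only [Matrix.mul_assoc]
      _ = _ := by rw [hsym, Matrix.one_mul]
  have hu : IsUnit x := IsUnit.of_mul_eq_one _ hright
  rw [hx, hτ, hε, Matrix.fromBlocks_map, Matrix.fromBlocks_transpose] at hkey
  rw [hx, hε, ← Matrix.fromBlocks_one] at hsym
  simp only [Matrix.fromBlocks_multiply, Matrix.fromBlocks_inj, Matrix.mul_zero, Matrix.zero_mul,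
    add_zero, zero_add, Matrix.one_mul, Matrix.mul_one, Matrix.neg_mul, Matrix.mul_neg,
    neg_neg] at hkey hsym
  obtain ⟨k1, k2, k3, k4⟩ := hkey
  obtain ⟨s1, s2, s3, s4⟩ := hsym
  have hc : τ₂ * (b.map ⇑σ)ᵀ * τ₁⁻¹ = -c := by
    rw [← k3, Matrix.neg_mul, Matrix.mul_assoc, Matrix.mul_nonsing_inv _ d1, Matrix.mul_one]
  refine ⟨hu, hinv, ?_, ?_, ?_, ?_, ?_, ?_, ?_⟩
  · rw [← k1, Matrix.mul_assoc, Matrix.mul_nonsing_inv _ d1, Matrix.mul_one]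
  · rw [← k4, Matrix.mul_assoc, Matrix.mul_nonsing_inv _ d2, Matrix.mul_one]
  · rw [hc, neg_neg]
  · rw [hc, ← s1, Matrix.mul_neg]; abel
  · rw [hc, ← s4, Matrix.neg_mul]; abel
  · rw [← sub_eq_zero, ← s2]; abel
  · rw [hc, ← sub_eq_zero, ← s3, Matrix.neg_mul, Matrix.mul_neg]; abel
end

section
/- Let F be a field and x = [[A,B],[C,D]] ∈ M_{2n}(F) (with A,B,C,D ∈ M_n(F)) satisfying the relations A² = I_n + BC, D² = I_n + CB, AB = BD, CA = DC, and assume B is invertible. Then the map h₂ ↦ (B·h₂·B⁻¹, h₂) is a group isomorphism from the centralizer {h₂ ∈ GL_n(F) : h₂D = Dh₂} of D onto the simultaneous stabilizer {(h₁,h₂) ∈ GL_n(F) × GL_n(F) : h₁Ah₁⁻¹ = A, h₁Bh₂⁻¹ = B, h₂Ch₁⁻¹ = C, h₂Dh₂⁻¹ = D}. In particular every pair (h₁,h₂) in the stabilizer satisfies h₁ = B·h₂·B⁻¹. -/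
open Matrix

/-- on the invertible locus of the linear symmetric space, the map
`h₂ ↦ (B h₂ B⁻¹, h₂)` is a group isomorphism from the centralizer of `D` in `GL_n(F)`
onto the simultaneous stabilizer of `x = [[A,B],[C,D]]` in `GL_n(F) × GL_n(F)`. -/
theorem statement2 {F : Type*} [Field F] {n : ℕ}
    (A B C D : Matrix (Fin n) (Fin n) F)
    (h1 : A * A = 1 + B * C) (h2 : D * D = 1 + C * B)
    (h3 : A * B = B * D) (h4 : C * A = D * C)
    (hB : IsUnit B) :
    ∃ φ : GL (Fin n) F → GL (Fin n) F × GL (Fin n) F,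
      (∀ h : GL (Fin n) F,
          ((φ h).1 : Matrix (Fin n) (Fin n) F) =
              B * (h : Matrix (Fin n) (Fin n) F) * B⁻¹ ∧
            (φ h).2 = h) ∧
      (∀ h h' : GL (Fin n) F, φ (h * h') = φ h * φ h') ∧
      Set.BijOn φ
        {h : GL (Fin n) F |
          (h : Matrix (Fin n) (Fin n) F) * D = D * (h : Matrix (Fin n) (Fin n) F)}
        {p : GL (Fin n) F × GL (Fin n) F |
          (p.1 : Matrix (Fin n) (Fin n) F) * A *
              ((p.1⁻¹ : GL (Fin n) F) : Matrix (Fin n) (Fin n) F) = A ∧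
          (p.1 : Matrix (Fin n) (Fin n) F) * B *
              ((p.2⁻¹ : GL (Fin n) F) : Matrix (Fin n) (Fin n) F) = B ∧
          (p.2 : Matrix (Fin n) (Fin n) F) * C *
              ((p.1⁻¹ : GL (Fin n) F) : Matrix (Fin n) (Fin n) F) = C ∧
          (p.2 : Matrix (Fin n) (Fin n) F) * D *
              ((p.2⁻¹ : GL (Fin n) F) : Matrix (Fin n) (Fin n) F) = D} ∧
      ∀ p : GL (Fin n) F × GL (Fin n) F,
        (p.1 : Matrix (Fin n) (Fin n) F) * A *
            ((p.1⁻¹ : GL (Fin n) F) : Matrix (Fin n) (Fin n) F) = A →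
        (p.1 : Matrix (Fin n) (Fin n) F) * B *
            ((p.2⁻¹ : GL (Fin n) F) : Matrix (Fin n) (Fin n) F) = B →
        (p.2 : Matrix (Fin n) (Fin n) F) * C *
            ((p.1⁻¹ : GL (Fin n) F) : Matrix (Fin n) (Fin n) F) = C →
        (p.2 : Matrix (Fin n) (Fin n) F) * D *
            ((p.2⁻¹ : GL (Fin n) F) : Matrix (Fin n) (Fin n) F) = D →
        (p.1 : Matrix (Fin n) (Fin n) F) =
          B * (p.2 : Matrix (Fin n) (Fin n) F) * B⁻¹ := by
  obtain ⟨b, rfl⟩ := hB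
  have hinv : ((b : Matrix (Fin n) (Fin n) F))⁻¹ = ((b⁻¹ : GL (Fin n) F) : Matrix (Fin n) (Fin n) F) :=
    (Matrix.coe_units_inv b).symm
  have key : ∀ p : GL (Fin n) F × GL (Fin n) F,
      (p.1 : Matrix (Fin n) (Fin n) F) * (b : Matrix (Fin n) (Fin n) F) *
            ((p.2⁻¹ : GL (Fin n) F) : Matrix (Fin n) (Fin n) F) = b →
      p.1 = b * p.2 * b⁻¹ := by
    intro p hp
    have h : p.1 * b * p.2⁻¹ = b := Units.ext (by simpa only [Units.val_mul] using hp)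
    rw [eq_mul_inv_iff_mul_eq]
    exact mul_inv_eq_iff_eq_mul.mp h
  refine ⟨fun h => (b * h * b⁻¹, h), ?_, ?_, ⟨?_, ?_, ?_⟩, ?_⟩
  · intro h
    exact ⟨by rw [hinv]; simp only [Units.val_mul], rfl⟩
  · intro h h'
    refine Prod.ext ?_ rfl
    change b * (h * h') * b⁻¹ = (b * h * b⁻¹) * (b * h' * b⁻¹)
    group
  · intro h hh
    simp only [Set.mem_setOf_eq] at hh ⊢
    have cb : C * (b : Matrix (Fin n) (Fin n) F) = D * D - 1 := by rw [h2]; abel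
    refine ⟨?_, ?_, ?_, ?_⟩
    · rw [Units.mul_inv_eq_iff_eq_mul]
      apply b.isUnit.mul_right_cancel
      simp only [Units.val_mul, mul_assoc, Units.inv_mul, mul_one]
      rw [h3, Units.inv_mul_cancel_left, hh, ← mul_assoc A, h3, mul_assoc]
    · rw [Units.mul_inv_eq_iff_eq_mul, ← Units.val_mul, ← Units.val_mul]
      congr 1
      group
    · rw [Units.mul_inv_eq_iff_eq_mul]
      apply b.isUnit.mul_right_cancel
      simp only [Units.val_mul, mul_assoc, Units.inv_mul, mul_one]
      rw [cb, ← mul_assoc C, cb, mul_sub, sub_mul, ← mul_assoc, hh, mul_assoc, hh, mul_one, one_mul,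
        mul_assoc]
    · rw [Units.mul_inv_eq_iff_eq_mul, hh]
  · intro h _ h' _ e
    exact congrArg Prod.snd e
  · rintro p ⟨_, hb, _, hd⟩
    refine ⟨p.2, ?_, Prod.ext (key p hb).symm rfl⟩
    exact (Units.mul_inv_eq_iff_eq_mul _).mp hd
  · intro p _ hb _ _
    rw [hinv, key p hb]
    simp only [Units.val_mul]
end

section
/- Let F be a field and X, Y ∈ M_n(F) with YX invertible, and let w ∈ M_{1,n}(F) be a row vector such that the rows w, w(YX), …, w(YX)^{n-1} span F^n. If h₁, h₂ ∈ GL_n(F) satisfy h₁·X·h₂⁻¹ = X, h₂·Y·h₁⁻¹ = Y, and w·h₂ = w, then h₁ = h₂ = I_n. -/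
open Matrix

/-- trivial stabilizer of strongly regular elements of the
extended infinitesimal linear symmetric space. -/
theorem statement5 {F : Type*} [Field F] {n : ℕ}
    (X Y : Matrix (Fin n) (Fin n) F) (hYX : IsUnit (Y * X)) (w : Fin n → F)
    (hspan : Submodule.span F
        (Set.range fun i : Fin n => Matrix.vecMul w ((Y * X) ^ (i : ℕ))) = ⊤)
    (h₁ h₂ : GL (Fin n) F)
    (hX : (h₁ : Matrix (Fin n) (Fin n) F) * X *
        ((h₂⁻¹ : GL (Fin n) F) : Matrix (Fin n) (Fin n) F) = X)
    (hY : (h₂ : Matrix (Fin n) (Fin n) F) * Y *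
        ((h₁⁻¹ : GL (Fin n) F) : Matrix (Fin n) (Fin n) F) = Y)
    (hw : Matrix.vecMul w (h₂ : Matrix (Fin n) (Fin n) F) = w) :
    h₁ = 1 ∧ h₂ = 1 := by
  have hX' : (h₁ : Matrix (Fin n) (Fin n) F) * X = X * (h₂ : Matrix (Fin n) (Fin n) F) := by
    rw [← Units.mul_inv_eq_iff_eq_mul]; exact hX
  have hY' : (h₂ : Matrix (Fin n) (Fin n) F) * Y = Y * (h₁ : Matrix (Fin n) (Fin n) F) := by
    rw [← Units.mul_inv_eq_iff_eq_mul]; exact hY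
  have hc : Commute (h₂ : Matrix (Fin n) (Fin n) F) (Y * X) := by
    change _ * (Y * X) = (Y * X) * _
    rw [← mul_assoc, hY', mul_assoc, hX', mul_assoc]
  have hlin : Matrix.vecMulLinear (h₂ : Matrix (Fin n) (Fin n) F) = LinearMap.id := by
    apply LinearMap.ext_on_range hspan
    intro i
    simp only [Matrix.vecMulLinear_apply, LinearMap.id_apply]
    rw [Matrix.vecMul_vecMul, ← (hc.pow_right (i : ℕ)).eq, ← Matrix.vecMul_vecMul, hw]
  have e2 : (h₂ : Matrix (Fin n) (Fin n) F) = 1 := by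
    apply Matrix.ext_of_single_vecMul
    intro i
    have := LinearMap.congr_fun hlin (Pi.single i 1)
    simpa using this
  have hXu : IsUnit X := by
    rw [Matrix.isUnit_iff_isUnit_det, Matrix.det_mul] at hYX
    rw [Matrix.isUnit_iff_isUnit_det]
    exact isUnit_of_mul_isUnit_right hYX
  refine ⟨Units.ext ?_, Units.ext e2⟩
  rw [e2, mul_one] at hX'
  exact hXu.mul_right_cancel (by simpa using hX')
end

section
/- Let F be a field, d : Fin n → F injective (pairwise distinct values), D = diag(d(1),…,d(n)) ∈ M_n(F), and w ∈ M_{1,n}(F) a row vector. Then the rows w, wD, …, wD^{n-1} are linearly independent (equivalently span F^n) if and only if every entry of w is nonzero. Moreover, if w and w' are two row vectors all of whose entries are nonzero, then there exists a unique g ∈ GL_n(F) commuting with D such that w·g = w', and this g is a diagonal matrix. -/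
open Matrix

/-- for `D = diag(d)` with distinct entries, `(D, w)` is strongly regular
iff all entries of `w` are nonzero, and the set of such `w` is a torsor under the
(diagonal) centralizer torus of `D`. -/
theorem statement7 {F : Type*} [Field F] {n : ℕ}
    (d : Fin n → F) (hd : Function.Injective d) (w : Fin n → F) :
    (LinearIndependent F
        (fun i : Fin n => Matrix.vecMul w ((diagonal d) ^ (i : ℕ))) ↔ ∀ j, w j ≠ 0) ∧
    (Submodule.span F
        (Set.range fun i : Fin n => Matrix.vecMul w ((diagonal d) ^ (i : ℕ))) = ⊤ ↔
      ∀ j, w j ≠ 0) ∧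
    ∀ w' : Fin n → F, (∀ j, w j ≠ 0) → (∀ j, w' j ≠ 0) →
      (∃! g : GL (Fin n) F,
          (g : Matrix (Fin n) (Fin n) F) * diagonal d =
              diagonal d * (g : Matrix (Fin n) (Fin n) F) ∧
            Matrix.vecMul w (g : Matrix (Fin n) (Fin n) F) = w') ∧
      ∀ g : GL (Fin n) F,
        (g : Matrix (Fin n) (Fin n) F) * diagonal d =
            diagonal d * (g : Matrix (Fin n) (Fin n) F) →
        Matrix.vecMul w (g : Matrix (Fin n) (Fin n) F) = w' →
        ∃ e : Fin n → F, (g : Matrix (Fin n) (Fin n) F) = diagonal e := by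
  have hli : LinearIndependent F
        (fun i : Fin n => Matrix.vecMul w ((diagonal d) ^ (i : ℕ))) ↔ ∀ j, w j ≠ 0 := by
    have e : (fun i : Fin n => Matrix.vecMul w ((diagonal d) ^ (i : ℕ))) =
        ((vandermonde d)ᵀ * diagonal w).row := by
      funext i j
      simp [Matrix.row, diagonal_pow, vecMul_diagonal, mul_diagonal, vandermonde_apply, mul_comm]
    rw [e, linearIndependent_rows_iff_isUnit, isUnit_iff_isUnit_det, det_mul, det_transpose,
      det_diagonal, isUnit_iff_ne_zero, mul_ne_zero_iff, Finset.prod_ne_zero_iff]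
    simp [det_vandermonde_ne_zero_iff.mpr hd]
  have hdiag : ∀ g : Matrix (Fin n) (Fin n) F, g * diagonal d = diagonal d * g →
      g = diagonal (fun i => g i i) := by
    intro g hg
    ext i j
    by_cases hij : i = j
    · subst hij; simp
    · have h := congrFun (congrFun hg i) j
      rw [mul_diagonal, diagonal_mul] at h
      rw [diagonal_apply_ne _ hij]
      by_contra h0
      apply hij
      apply hd
      apply mul_right_cancel₀ h0
      rw [← h, mul_comm]
  refine ⟨hli, ?_, ?_⟩
  · rw [← hli]
    constructor
    · intro h
      exact linearIndependent_of_top_le_span_of_card_eq_finrank h.ge (by simp)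
    · intro h
      exact h.span_eq_top_of_card_eq_finrank' (by simp)
  · intro w' hw hw'
    refine ⟨?_, fun g hg _ => ⟨_, hdiag _ hg⟩⟩
    have hdet : (diagonal (fun i => w' i / w i)).det ≠ 0 := by
      rw [det_diagonal, Finset.prod_ne_zero_iff]
      exact fun i _ => div_ne_zero (hw' i) (hw i)
    refine ⟨GeneralLinearGroup.mkOfDetNeZero _ hdet, ⟨?_, ?_⟩, ?_⟩
    · change diagonal _ * diagonal d = diagonal d * diagonal _
      rw [diagonal_mul_diagonal, diagonal_mul_diagonal]
      simp only [mul_comm]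
    · change vecMul w (diagonal _) = w'
      funext j
      rw [vecMul_diagonal]
      exact mul_div_cancel₀ _ (hw j)
    · rintro g ⟨hg, hgw⟩
      apply Units.ext
      change (g : Matrix (Fin n) (Fin n) F) = diagonal _
      rw [hdiag _ hg] at hgw ⊢
      congr 1
      funext j
      have h := congrFun hgw j
      rw [vecMul_diagonal] at h
      rw [eq_div_iff (hw j), mul_comm]
      exact h
end

section
/- Let F be a field, D₁ ∈ M_{n₁}(F), D₂ ∈ M_{n₂}(F), and D = fromBlocks(D₁, 0, 0, D₂) ∈ M_{n₁+n₂}(F). Let w ∈ M_{1,n₁+n₂}(F) be a row vector with blocks w₁ ∈ M_{1,n₁}(F) and w₂ ∈ M_{1,n₂}(F). If the rows w, wD, …, wD^{n₁+n₂-1} span F^{n₁+n₂}, then the rows w₁, w₁D₁, …, w₁D₁^{n₁-1} span F^{n₁} and the rows w₂, w₂D₂, …, w₂D₂^{n₂-1} span F^{n₂}. -/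
open Matrix

lemma aux_mem {F : Type*} [Field F] {n : ℕ} (D : Matrix (Fin n) (Fin n) F) (v : Fin n → F)
    (k : ℕ) : Matrix.vecMul v (D ^ k) ∈ Submodule.span F
        (Set.range fun i : Fin n => Matrix.vecMul v (D ^ (i : ℕ))) := by
  rcases Nat.eq_zero_or_pos n with rfl | hn
  · rw [Subsingleton.elim (Matrix.vecMul v (D ^ k)) 0]
    exact Submodule.zero_mem _
  · have hdeg : (Polynomial.X ^ k %ₘ D.charpoly).natDegree < n := by
      have h := Polynomial.natDegree_modByMonic_lt (Polynomial.X ^ k) (Matrix.charpoly_monic D)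
        (by
          intro h
          have h2 := Matrix.charpoly_natDegree_eq_dim D
          rw [h] at h2
          simp at h2
          omega)
      rwa [Matrix.charpoly_natDegree_eq_dim, Fintype.card_fin] at h
    rw [Matrix.pow_eq_aeval_mod_charpoly, Polynomial.aeval_eq_sum_range' hdeg,
      Matrix.vecMul_sum]
    refine Submodule.sum_mem _ fun i hi => ?_
    rw [Matrix.vecMul_smul]
    exact Submodule.smul_mem _ _ (Submodule.subset_span ⟨⟨i, Finset.mem_range.1 hi⟩, rfl⟩)

lemma aux_top {F : Type*} [Field F] {n m : ℕ} {V : Type*} [AddCommGroup V] [Module F V]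
    (D : Matrix (Fin n) (Fin n) F) (v : Fin n → F) (f : Fin m → V)
    (hf : Submodule.span F (Set.range f) = ⊤) (p : V →ₗ[F] (Fin n → F))
    (hp : Function.Surjective p) (h : ∀ i, p (f i) = Matrix.vecMul v (D ^ (i : ℕ))) :
    Submodule.span F (Set.range fun i : Fin n => Matrix.vecMul v (D ^ (i : ℕ))) = ⊤ := by
  rw [eq_top_iff, ← LinearMap.range_eq_top.2 hp, ← Submodule.map_top, ← hf, Submodule.map_span,
    Submodule.span_le]
  rintro _ ⟨_, ⟨i, rfl⟩, rfl⟩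
  rw [h]
  exact aux_mem D v i

/-- descent of strong regularity along a block-diagonal decomposition. -/
theorem statement8 {F : Type*} [Field F] {n₁ n₂ : ℕ}
    (D₁ : Matrix (Fin n₁) (Fin n₁) F) (D₂ : Matrix (Fin n₂) (Fin n₂) F)
    (w : Fin n₁ ⊕ Fin n₂ → F)
    (hspan : Submodule.span F
        (Set.range fun i : Fin (n₁ + n₂) =>
          Matrix.vecMul w ((fromBlocks D₁ 0 0 D₂) ^ (i : ℕ))) = ⊤) :
    Submodule.span F
        (Set.range fun i : Fin n₁ =>
          Matrix.vecMul (w ∘ Sum.inl) (D₁ ^ (i : ℕ))) = ⊤ ∧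
    Submodule.span F
        (Set.range fun i : Fin n₂ =>
          Matrix.vecMul (w ∘ Sum.inr) (D₂ ^ (i : ℕ))) = ⊤ := by
  constructor
  · refine aux_top D₁ _ _ hspan (LinearMap.funLeft F F Sum.inl)
      (LinearMap.funLeft_surjective_of_injective F F _ Sum.inl_injective) fun i => ?_
    ext j
    simp [Matrix.fromBlocks_diagonal_pow, Matrix.vecMul_fromBlocks, LinearMap.funLeft_apply]
  · refine aux_top D₂ _ _ hspan (LinearMap.funLeft F F Sum.inr)
      (LinearMap.funLeft_surjective_of_injective F F _ Sum.inr_injective) fun i => ?_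
    ext j
    simp [Matrix.fromBlocks_diagonal_pow, Matrix.vecMul_fromBlocks, LinearMap.funLeft_apply]
end

section
/- Let E/F be a quadratic Galois extension of fields of characteristic zero with σ the nontrivial element of Gal(E/F), and M* := (M^σ)ᵀ. Let b, b' ∈ GL_n(E) and h₁, h₂ ∈ GL_n(E) satisfy b' = h₁·b·h₂⁻¹ and b' = (h₂*)⁻¹·b·h₁*. Then: (i) h₂*·h₁·b = b·h₁*·h₂, and det(h₂*·h₁) is fixed by σ (so lies in F); (ii) det(b')·det(b)⁻¹ = det(h₁)·det(h₂)⁻¹, and this element is fixed by σ (so lies in F); (iii) det(h₁·h₂⁻¹) = det(h₂*·h₁) · (det(h₂)·σ(det(h₂)))⁻¹, i.e., det(h₁h₂⁻¹) and det(h₂*h₁) differ by the norm N_{E/F}(det h₂) ∈ N_{E/F}(E^×). -/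
open Matrix

/-- determinant identities underlying the endoscopic character `ε`. -/
theorem statement15 {F E : Type*} [Field F] [Field E] [CharZero F] [Algebra F E]
    [IsGalois F E] (hdim : Module.finrank F E = 2)
    (σ : E ≃ₐ[F] E) (hσ : σ ≠ AlgEquiv.refl)
    {n : ℕ} (b b' h₁ h₂ : Matrix (Fin n) (Fin n) E)
    (hb : IsUnit b) (hb' : IsUnit b') (hh₁ : IsUnit h₁) (hh₂ : IsUnit h₂)
    (e1 : b' = h₁ * b * h₂⁻¹)
    (e2 : b' = ((h₂.map ⇑σ)ᵀ)⁻¹ * b * (h₁.map ⇑σ)ᵀ) :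
    ((h₂.map ⇑σ)ᵀ * h₁ * b = b * ((h₁.map ⇑σ)ᵀ * h₂) ∧
      σ ((h₂.map ⇑σ)ᵀ * h₁).det = ((h₂.map ⇑σ)ᵀ * h₁).det ∧
      ((h₂.map ⇑σ)ᵀ * h₁).det ∈ Set.range (algebraMap F E)) ∧
    (b'.det * b.det⁻¹ = h₁.det * h₂.det⁻¹ ∧
      σ (b'.det * b.det⁻¹) = b'.det * b.det⁻¹ ∧
      b'.det * b.det⁻¹ ∈ Set.range (algebraMap F E)) ∧
    (h₁ * h₂⁻¹).det = ((h₂.map ⇑σ)ᵀ * h₁).det * (h₂.det * σ h₂.det)⁻¹ := by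
  have hfd : FiniteDimensional F E := FiniteDimensional.of_finrank_pos (by omega)
  have hcard : Nat.card (E ≃ₐ[F] E) = 2 := by
    rw [IsGalois.card_aut_eq_finrank, hdim]
  have hss : ∀ x : E, σ (σ x) = x := by
    intro x
    have h : σ ^ 2 = 1 := by rw [← hcard]; exact pow_card_eq_one'
    have h2 := congrArg (fun f : E ≃ₐ[F] E => f x) h
    simpa [pow_two] using h2
  have hfix : ∀ x : E, σ x = x → x ∈ Set.range (algebraMap F E) := by
    intro x hx
    rw [IsGalois.mem_range_algebraMap_iff_fixed]
    intro g
    by_cases hg : g = 1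
    · simp [hg]
    · have hσ1 : σ ≠ 1 := hσ
      obtain ⟨y, -, hy⟩ := (Nat.card_eq_two_iff' (1 : E ≃ₐ[F] E)).1 hcard
      rw [hy g hg, ← hy σ hσ1]
      exact hx
  have hdet : ∀ M : Matrix (Fin n) (Fin n) E, (M.map ⇑σ)ᵀ.det = σ M.det := by
    intro M
    rw [det_transpose]
    exact (AlgEquiv.map_det σ M).symm
  have hc : b.det ≠ 0 := ((isUnit_iff_isUnit_det b).1 hb).ne_zero
  have hd : h₂.det ≠ 0 := ((isUnit_iff_isUnit_det h₂).1 hh₂).ne_zero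
  have hsd : σ h₂.det ≠ 0 := by simpa using hd
  have hu : IsUnit h₂.det := hd.isUnit
  have hus : IsUnit (h₂.map ⇑σ)ᵀ.det := by rw [hdet]; exact hsd.isUnit
  have hinv : ∀ M : Matrix (Fin n) (Fin n) E, (M⁻¹).det = M.det⁻¹ := by
    intro M
    rw [det_nonsing_inv, Ring.inverse_eq_inv']
  have d1 : b'.det = h₁.det * b.det * h₂.det⁻¹ := by
    rw [e1, det_mul, det_mul, hinv]
  have d2 : b'.det = (σ h₂.det)⁻¹ * b.det * σ h₁.det := by
    rw [e2, det_mul, det_mul, hinv, hdet, hdet]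
  have key : σ h₂.det * h₁.det = h₂.det * σ h₁.det := by
    rw [d1] at d2
    field_simp at d2
    linear_combination d2
  have k1 : σ ((h₂.map ⇑σ)ᵀ * h₁).det = ((h₂.map ⇑σ)ᵀ * h₁).det := by
    rw [det_mul, hdet, map_mul, hss, key]
  have k2 : b'.det * b.det⁻¹ = h₁.det * h₂.det⁻¹ := by
    rw [d1]; field_simp
  have k3 : σ (b'.det * b.det⁻¹) = b'.det * b.det⁻¹ := by
    rw [k2, map_mul, map_inv₀]
    field_simp
    linear_combination -key
  refine ⟨⟨?_, k1, hfix _ k1⟩, ⟨k2, k3, hfix _ k3⟩, ?_⟩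
  · have q1 : b' * h₂ = h₁ * b := by
      rw [e1, nonsing_inv_mul_cancel_right _ _ hu]
    have q2 : (h₂.map ⇑σ)ᵀ * b' = b * (h₁.map ⇑σ)ᵀ := by
      rw [e2, Matrix.mul_assoc, mul_nonsing_inv_cancel_left _ _ hus]
    rw [Matrix.mul_assoc, ← q1, ← Matrix.mul_assoc, q2, Matrix.mul_assoc]
  · rw [det_mul, det_mul, hinv, hdet]
    field_simp
end
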